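/- arXiv:1802.03630 — 2 statements merged into one kernel-verified Lean document; each statement's English description precedes it below -/
import Mathlib

section
/- Fix y₀ with 1/2 < y₀ ≤ 1. There exist a constant C > 0 and n₀ ≥ 1 such that for all n ≥ n₀ and all x ∈ ℝ: each arc J̃ₙ(g^j(x)+k) = {u + i·|mₙ(u)|·y₀ : u ∈ Jₙ(g^j(x)+k)} for 0 ≤ j < q_{n+1} and k ∈ ℤ has hyperbolic diameter at most C (with respect to the Poincaré distance of the upper half-plane ℍ), and the union of the intervals Jₙ(g^j(x)+k) over 0 ≤ j < q_{n+1} and k ∈ ℤ is all of ℝ, so these arcs cover the whole curve Γₙ = {u + i·|mₙ(u)|·y₀ : u ∈ ℝ}. -/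
open Filter Topology

/-- Gauss-map orbit of `α`: `α₀ = α`, `αₙ₊₁ = 1 / fract(αₙ)`. -/
noncomputable def cfGauss (α : ℝ) : ℕ → ℝ
  | 0 => α
  | n + 1 => (Int.fract (cfGauss α n))⁻¹

/-- Partial quotients `aₙ` of the continued fraction of `α`. -/
noncomputable def cfA (α : ℝ) (n : ℕ) : ℤ := ⌊cfGauss α n⌋

/-- Numerators `pₙ` of the convergents of `α`. -/
noncomputable def cfP (α : ℝ) : ℕ → ℤ
  | 0 => cfA α 0
  | 1 => cfA α 1 * cfA α 0 + 1
  | n + 2 => cfA α (n + 2) * cfP α (n + 1) + cfP α n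

/-- Denominators `qₙ` of the convergents of `α` (as natural numbers). -/
noncomputable def cfQ (α : ℝ) : ℕ → ℕ
  | 0 => 1
  | 1 => (cfA α 1).toNat
  | n + 2 => (cfA α (n + 2)).toNat * cfQ α (n + 1) + cfQ α n

/-- `gₙ(x) = g^{qₙ}(x) − pₙ`. -/
noncomputable def cfIter (g : ℝ → ℝ) (α : ℝ) (n : ℕ) (x : ℝ) : ℝ :=
  g^[cfQ α n] x - cfP α n

/-- The point `x + i |mₙ(x)| y₀` of the flow curve at height `y₀` over `x`. -/
noncomputable def liftPt (g : ℝ → ℝ) (α : ℝ) (n : ℕ) (y₀ x : ℝ) : ℂ :=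
  (x : ℂ) + Complex.I * ((|cfIter g α n x - x| : ℝ) : ℂ) * ((y₀ : ℝ) : ℂ)

/-- `Jₙ(x)`: the closed interval with endpoints `gₙ⁻¹(x)` and `gₙ(x)`. -/
noncomputable def cfJ (g : ℝ → ℝ) (α : ℝ) (n : ℕ) (x : ℝ) : Set ℝ :=
  Set.uIcc (Function.invFun (cfIter g α n) x) (cfIter g α n x)

/-! ### Continued fraction facts -/

theorem cfGauss_irrational {α : ℝ} (hα : Irrational α) (n : ℕ) : Irrational (cfGauss α n) := by
  induction n with
  | zero => exact hα
  | succ n ih =>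
    have : Irrational (Int.fract (cfGauss α n)) := by
      rw [Int.fract]; exact ih.sub_intCast _
    exact this.inv

theorem cfFract_pos {α : ℝ} (hα : Irrational α) (n : ℕ) : 0 < Int.fract (cfGauss α n) := by
  have h := cfGauss_irrational hα n
  have h2 : Irrational (Int.fract (cfGauss α n)) := by
      rw [Int.fract]; exact h.sub_intCast _
  exact lt_of_le_of_ne (Int.fract_nonneg _) (Ne.symm h2.ne_zero)

theorem cfA_pos {α : ℝ} (hα : Irrational α) (n : ℕ) : 1 ≤ cfA α (n + 1) := by
  have h := cfFract_pos hα n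
  have h1 := Int.fract_lt_one (cfGauss α n)
  rw [cfA, Int.le_floor, cfGauss]
  push_cast
  exact (one_le_inv₀ h).2 h1.le

theorem cfA_cast {α : ℝ} (hα : Irrational α) (n : ℕ) :
    (((cfA α (n + 1)).toNat : ℕ) : ℝ) = (cfA α (n + 1) : ℝ) := by
  have : (((cfA α (n + 1)).toNat : ℕ) : ℤ) = cfA α (n + 1) :=
    Int.toNat_of_nonneg (by linarith [cfA_pos hα n])
  exact_mod_cast congrArg (fun z : ℤ => (z : ℝ)) this

theorem cfQ_pos {α : ℝ} (hα : Irrational α) (n : ℕ) : 0 < cfQ α n ∧ cfQ α n ≤ cfQ α (n + 1) := by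
  have ha : ∀ n, 1 ≤ (cfA α (n + 1)).toNat := fun n => by have := cfA_pos hα n; omega
  induction n with
  | zero => exact ⟨by simp [cfQ], by simpa [cfQ] using ha 0⟩
  | succ n ih =>
    refine ⟨by omega, ?_⟩
    rw [cfQ]
    have := ha (n + 1)
    nlinarith [Nat.mul_le_mul_right (cfQ α (n + 1)) this]

/-- `δₙ = qₙ α - pₙ`. -/
noncomputable def cfD (α : ℝ) (n : ℕ) : ℝ := cfQ α n * α - cfP α n

theorem cfD_rec {α : ℝ} (hα : Irrational α) (n : ℕ) :
    cfD α (n + 2) = cfA α (n + 2) * cfD α (n + 1) + cfD α n := by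
  simp only [cfD, cfQ, cfP]
  push_cast
  rw [cfA_cast hα (n + 1)]
  ring

theorem cfD_succ {α : ℝ} (hα : Irrational α) (n : ℕ) :
    cfD α (n + 1) = - cfD α n * Int.fract (cfGauss α (n + 1)) := by
  have key : ∀ n, (cfA α (n + 1) : ℝ) * Int.fract (cfGauss α n) =
      1 - Int.fract (cfGauss α n) * Int.fract (cfGauss α (n + 1)) := by
    intro n
    have h := (cfFract_pos hα n).ne'
    have h2 : (cfA α (n + 1) : ℝ) =
        (Int.fract (cfGauss α n))⁻¹ - Int.fract (cfGauss α (n + 1)) := by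
      have := Int.self_sub_floor (cfGauss α (n + 1))
      have e : cfGauss α (n + 1) = (Int.fract (cfGauss α n))⁻¹ := rfl
      rw [← this, ← e, cfA]; ring
    rw [h2]; field_simp
  induction n with
  | zero =>
    have h0 : Int.fract (cfGauss α 0) = α - cfA α 0 := by rw [Int.fract, cfA, cfGauss]
    have := key 0
    simp only [cfD, cfQ, cfP]
    rw [cfA_cast hα 0]
    rw [h0] at this
    push_cast
    linear_combination this
  | succ n ih =>
    rw [cfD_rec hα, show n + 1 + 1 = n + 2 from rfl]
    have := key (n + 1)
    have h := (cfFract_pos hα (n + 1)).ne'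
    apply mul_right_cancel₀ h
    linear_combination cfD α (n + 1) * this + ih

theorem cfD_ne {α : ℝ} (hα : Irrational α) (n : ℕ) : cfD α n ≠ 0 := by
  induction n with
  | zero =>
    have := (cfFract_pos hα 0).ne'
    have h0 : Int.fract (cfGauss α 0) = cfD α 0 := by
      rw [Int.fract, cfD, cfQ, cfP, cfA, cfGauss]; simp
    rwa [h0] at this
  | succ n ih =>
    rw [cfD_succ hα]
    exact mul_ne_zero (neg_ne_zero.2 ih) (cfFract_pos hα _).ne'

theorem cf_det {α : ℝ} (hα : Irrational α) (n : ℕ) :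
    cfP α (n + 1) * (cfQ α n : ℤ) - cfP α n * (cfQ α (n + 1) : ℤ) = (-1) ^ n := by
  have hA : ∀ n, (((cfA α (n + 1)).toNat : ℕ) : ℤ) = cfA α (n + 1) := fun n =>
    Int.toNat_of_nonneg (by linarith [cfA_pos hα n])
  induction n with
  | zero => simp only [cfP, cfQ, hA 0]; push_cast; ring
  | succ n ih =>
    rw [pow_succ, ← ih]
    simp only [cfP, cfQ]
    push_cast
    rw [hA (n + 1)]
    ring

theorem cf_coprime {α : ℝ} (hα : Irrational α) (n : ℕ) :
    ∃ b c : ℤ, cfP α n * b + c * (cfQ α n : ℤ) = 1 := by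
  have h := cf_det hα n
  rcases neg_one_pow_eq_or ℤ n with h1 | h1 <;> rw [h1] at h
  · exact ⟨-(cfQ α (n + 1) : ℤ), cfP α (n + 1), by linarith⟩
  · exact ⟨(cfQ α (n + 1) : ℤ), -cfP α (n + 1), by linarith⟩

theorem cfD_bound {α : ℝ} (hα : Irrational α) (n : ℕ) : |cfD α n| * cfQ α n ≤ 1 := by
  have h := cf_det hα n
  have h' : (cfP α (n + 1) : ℝ) * (cfQ α n : ℝ) - cfP α n * (cfQ α (n + 1) : ℝ) = (-1) ^ n := by
    exact_mod_cast h
  have h2 : cfD α n * (cfQ α (n + 1) + cfQ α n * Int.fract (cfGauss α (n + 1))) = (-1) ^ n := by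
    have := cfD_succ hα n
    have e : cfQ α (n + 1) * cfD α n - cfQ α n * cfD α (n + 1) = (-1) ^ n := by
      rw [← h', cfD, cfD]; ring
    rw [← e, this]; ring
  have h3 := congrArg abs h2
  have hf := (cfFract_pos hα (n + 1)).le
  rw [abs_mul, abs_pow, abs_neg, abs_one, one_pow,
    abs_of_nonneg (a := (cfQ α (n + 1) + cfQ α n * Int.fract (cfGauss α (n + 1)) : ℝ))
      (by positivity)] at h3
  have hq : (cfQ α n : ℝ) ≤ cfQ α (n + 1) := by exact_mod_cast (cfQ_pos hα n).2
  rw [← h3]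
  apply mul_le_mul_of_nonneg_left _ (abs_nonneg _)
  have : 0 ≤ cfQ α n * Int.fract (cfGauss α (n + 1)) := by positivity
  linarith

/-! ### Denjoy-Koksma type inequality -/

theorem sum_shift (q : ℕ) (hq : 0 < q) (p b c : ℤ) (hb : p * b + c * (q : ℤ) = 1) (s : ℤ)
    (f : ℕ → ℝ) :
    ∑ k ∈ Finset.range q, f ((((k : ℤ) + s) * b % (q : ℤ)).toNat) = ∑ i ∈ Finset.range q, f i := by
  have hq' : (0 : ℤ) < q := by exact_mod_cast hq
  have hmaps : Set.MapsTo (fun k : ℕ => (((k : ℤ) + s) * b % (q : ℤ)).toNat)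
      (Finset.range q : Set ℕ) (Finset.range q : Set ℕ) := by
    intro k _
    have h1 := Int.emod_nonneg (((k : ℤ) + s) * b) hq'.ne'
    have h2 := Int.emod_lt_of_pos (((k : ℤ) + s) * b) hq'
    simp only [Finset.coe_range, Set.mem_Iio]
    omega
  have hinj : Set.InjOn (fun k : ℕ => (((k : ℤ) + s) * b % (q : ℤ)).toNat)
      (Finset.range q : Set ℕ) := by
    intro k hk l hl hkl
    simp only [Finset.coe_range, Set.mem_Iio] at hk hl
    simp only at hkl
    have h1 := Int.emod_nonneg (((k : ℤ) + s) * b) hq'.ne'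
    have h2 := Int.emod_nonneg (((l : ℤ) + s) * b) hq'.ne'
    have h3 : ((k : ℤ) + s) * b % (q : ℤ) = ((l : ℤ) + s) * b % (q : ℤ) := by omega
    have h4 : (q : ℤ) ∣ ((l : ℤ) + s) * b - ((k : ℤ) + s) * b := Int.ModEq.dvd h3
    have h5 : (q : ℤ) ∣ (l : ℤ) - k := by
      obtain ⟨d, hd⟩ := h4
      exact ⟨p * d + c * ((l : ℤ) - k), by linear_combination p * hd - ((l : ℤ) - k) * hb⟩
    have h6 : (l : ℤ) - k = 0 := by
      apply Int.eq_zero_of_abs_lt_dvd h5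
      rw [abs_lt]; constructor <;> omega
    omega
  exact Finset.sum_nbij (fun k : ℕ => (((k : ℤ) + s) * b % (q : ℤ)).toNat) hmaps hinj
    (Finset.surjOn_of_injOn_of_card_le _ hmaps hinj le_rfl) (fun _ _ => rfl)

theorem h_iter {g h : ℝ → ℝ} {α : ℝ} (hh : ∀ x, h (g x) = h x + α) (m : ℕ) (x : ℝ) :
    h (g^[m] x) = h x + m * α := by
  induction m with
  | zero => simp
  | succ m ih => rw [Function.iterate_succ_apply', hh, ih]; push_cast; ring

/-- The orbit points of `x`, listed along the line. -/
noncomputable def orbPt (g : ℝ → ℝ) (p b : ℤ) (q : ℕ) (x : ℝ) (k : ℤ) : ℝ :=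
  g^[(k * b % (q : ℤ)).toNat] x + (((k - (k * b % (q : ℤ)) * p) / (q : ℤ) : ℤ) : ℝ)

theorem orbPt_add {g : ℝ → ℝ} {p b : ℤ} {q : ℕ} (hq : 0 < q) (x : ℝ) (k : ℤ) :
    orbPt g p b q x (k + q) = orbPt g p b q x k + 1 := by
  have hq' : (q : ℤ) ≠ 0 := by exact_mod_cast hq.ne'
  have h1 : (k + q) * b % (q : ℤ) = k * b % (q : ℤ) := by
    rw [show (k + q) * b = k * b + q * b by ring, Int.add_mul_emod_self_left]
  rw [orbPt, orbPt, h1, show k + q - (k * b % (q : ℤ)) * p = (k - (k * b % (q : ℤ)) * p) + q by ring,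
    Int.add_ediv_of_dvd_right (dvd_refl _), Int.ediv_self hq']
  push_cast; ring

theorem orbPt_h {g h : ℝ → ℝ} {α : ℝ} (hh : ∀ x, h (g x) = h x + α)
    (hper : ∀ x, ∀ m : ℤ, h (x + m) = h x + m)
    {p b c : ℤ} {q : ℕ} (hq : 0 < q) (hb : p * b + c * (q : ℤ) = 1)
    (hδ : |q * α - p| * q ≤ 1) (x : ℝ) (k : ℤ) :
    |q * (h (orbPt g p b q x k) - h x) - k| < 1 := by
  have hq' : (0 : ℤ) < q := by exact_mod_cast hq
  have hqr : (0 : ℝ) < q := by exact_mod_cast hq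
  have h1 := Int.emod_nonneg (k * b) hq'.ne'
  have h2 := Int.emod_lt_of_pos (k * b) hq'
  have hdvd : (q : ℤ) ∣ k - (k * b % (q : ℤ)) * p := by
    have e := Int.mul_ediv_add_emod (k * b) q
    exact ⟨(k * b / q) * p + k * c, by linear_combination -p * e - k * hb⟩
  obtain ⟨l, hl⟩ := hdvd
  have hl' : (k - (k * b % (q : ℤ)) * p) / (q : ℤ) = l := by
    rw [hl, Int.mul_ediv_cancel_left _ hq'.ne']
  obtain ⟨i, hi⟩ := Int.eq_ofNat_of_zero_le h1
  rw [orbPt, hl', hper, h_iter hh]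
  rw [hi] at h2 hl ⊢
  have hlr : (k : ℝ) - i * p = q * l := by exact_mod_cast hl
  have hiq : (i : ℝ) < q := by exact_mod_cast h2
  rw [show ((i : ℤ)).toNat = i from Int.toNat_natCast i]
  have e : (q : ℝ) * (h x + i * α + l - h x) - k = i * (q * α - p) := by linear_combination -hlr
  rw [e, abs_mul, abs_of_nonneg (by positivity)]
  by_cases h0 : |(q : ℝ) * α - p| = 0
  · rw [h0]; simp
  · have : 0 < |(q : ℝ) * α - p| := lt_of_le_of_ne (abs_nonneg _) (Ne.symm h0)
    nlinarith

theorem koksma {g h : ℝ → ℝ} {α : ℝ} (hh : ∀ x, h (g x) = h x + α) (hmono : Monotone h)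
    (hper : ∀ x, ∀ m : ℤ, h (x + m) = h x + m)
    {p b c : ℤ} {q : ℕ} (hq : 0 < q) (hb : p * b + c * (q : ℤ) = 1)
    (hδ : |q * α - p| * q ≤ 1) {φ : ℝ → ℝ} {L : ℝ} (hL : 0 ≤ L)
    (hφ : ∀ a b, |φ a - φ b| ≤ L * |a - b|)
    (hφper : ∀ x, ∀ m : ℤ, φ (x + m) = φ x) (x y : ℝ) :
    |∑ i ∈ Finset.range q, φ (g^[i] x) - ∑ i ∈ Finset.range q, φ (g^[i] y)| ≤ 6 * L := by
  have hqr : (0 : ℝ) < q := by exact_mod_cast hq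
  set X := orbPt g p b q x with hX
  set Y := orbPt g p b q y with hY
  set s : ℤ := ⌊q * (h x - h y)⌋ with hs
  have hs1 := Int.floor_le ((q : ℝ) * (h x - h y))
  have hs2 := Int.lt_floor_add_one ((q : ℝ) * (h x - h y))
  rw [← hs] at hs1 hs2
  have hXh := orbPt_h hh hper hq hb hδ x
  have hYh := orbPt_h hh hper hq hb hδ y
  rw [← hX] at hXh
  rw [← hY] at hYh
  have lt_of_h : ∀ u v, q * h u < q * h v → u < v := fun u v huv =>
    hmono.reflect_lt (lt_of_mul_lt_mul_left huv hqr.le)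
  have hdist : ∀ k : ℤ, |X k - Y (k + s)| ≤ X (k + 3) - X (k + (-3)) := by
    intro k
    have a0 := abs_lt.1 (hXh k)
    have a1 := abs_lt.1 (hXh (k + 3))
    have a2 := abs_lt.1 (hXh (k + (-3)))
    have a3 := abs_lt.1 (hYh (k + s))
    push_cast at a0 a1 a2 a3
    have b1 : X k < X (k + 3) := lt_of_h _ _ (by nlinarith)
    have b2 : X (k + (-3)) < X k := lt_of_h _ _ (by nlinarith)
    have b3 : Y (k + s) < X (k + 3) := lt_of_h _ _ (by nlinarith)
    have b4 : X (k + (-3)) < Y (k + s) := lt_of_h _ _ (by nlinarith)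
    rw [abs_le]; constructor <;> linarith
  have hsx : ∑ i ∈ Finset.range q, φ (g^[i] x) = ∑ k ∈ Finset.range q, φ (X k) := by
    rw [← sum_shift q hq p b c hb 0 (fun i => φ (g^[i] x))]
    refine Finset.sum_congr rfl fun k _ => ?_
    rw [hX, orbPt, hφper, add_zero]
  have hsy : ∑ i ∈ Finset.range q, φ (g^[i] y) = ∑ k ∈ Finset.range q, φ (Y (k + s)) := by
    rw [← sum_shift q hq p b c hb s (fun i => φ (g^[i] y))]
    refine Finset.sum_congr rfl fun k _ => ?_
    rw [hY, orbPt, hφper]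
  have hF : ∀ m : ℤ, ∑ k ∈ Finset.range q, X (k + (m + 1)) =
      ∑ k ∈ Finset.range q, X (k + m) + 1 := by
    intro m
    have := Finset.sum_range_sub (fun k : ℕ => X (k + m)) q
    rw [Finset.sum_sub_distrib] at this
    have e : X ((q : ℤ) + m) = X m + 1 := by rw [add_comm, hX, orbPt_add hq]
    rw [e] at this
    simp only [Nat.cast_add, Nat.cast_one, Nat.cast_zero, zero_add] at this
    have e2 : ∀ k : ℕ, (k : ℤ) + 1 + m = k + (m + 1) := fun k => by ring
    simp only [e2] at this
    linarith
  have hF6 : ∑ k ∈ Finset.range q, X (k + 3) = ∑ k ∈ Finset.range q, X (k + (-3)) + 6 := by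
    have c1 := hF (-3)
    have c2 := hF (-2)
    have c3 := hF (-1)
    have c4 := hF 0
    have c5 := hF 1
    have c6 := hF 2
    norm_num at c1 c2 c3 c4 c5 c6 ⊢
    linarith
  rw [hsx, hsy, ← Finset.sum_sub_distrib]
  calc |∑ k ∈ Finset.range q, (φ (X k) - φ (Y (k + s)))|
      ≤ ∑ k ∈ Finset.range q, |φ (X k) - φ (Y (k + s))| := Finset.abs_sum_le_sum_abs _ _
    _ ≤ ∑ k ∈ Finset.range q, L * (X (k + 3) - X (k + (-3))) :=
        Finset.sum_le_sum fun k _ => (hφ _ _).trans (mul_le_mul_of_nonneg_left (hdist k) hL)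
    _ = 6 * L := by
        rw [← Finset.mul_sum, Finset.sum_sub_distrib, hF6]; ring

/-! ### Distortion bounds -/

theorem exists_lipschitz_log_deriv (g : ℝ → ℝ) (hganal : ∀ x : ℝ, AnalyticAt ℝ g x)
    (hgder : ∀ x : ℝ, 0 < deriv g x) (hgper : ∀ x : ℝ, g (x + 1) = g x + 1) :
    ∃ L : ℝ, 0 ≤ L ∧ (∀ a b, |Real.log (deriv g a) - Real.log (deriv g b)| ≤ L * |a - b|) ∧
      (∀ x, ∀ m : ℤ, Real.log (deriv g (x + m)) = Real.log (deriv g x)) := by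
  have hdper : Function.Periodic (fun x => Real.log (deriv g x)) 1 := by
    intro x
    have h1 : (fun y => g (y + 1)) = fun y => g y + 1 := funext hgper
    have h2 := congrArg (fun f => deriv f x) h1
    simp only [deriv_comp_add_const, deriv_add_const] at h2
    simp only [h2]
  have hCD : ContDiff ℝ 1 (fun x => Real.log (deriv g x)) := by
    apply ContDiff.log
    · rw [contDiff_iff_contDiffAt]
      intro x
      exact (hganal x).deriv.contDiffAt
    · exact fun x => (hgder x).ne'
  have hcont := hCD.continuous_deriv le_rfl
  have hper' : Function.Periodic (deriv (fun x => Real.log (deriv g x))) 1 := by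
    intro x
    have h1 : (fun y => Real.log (deriv g (y + 1))) = fun y => Real.log (deriv g y) := funext hdper
    have h2 := congrArg (fun f => deriv f x) h1
    rw [← h2]
    exact (deriv_comp_add_const (fun y => Real.log (deriv g y)) 1 x).symm
  obtain ⟨L, hL⟩ := (isCompact_Icc (a := (0 : ℝ)) (b := 1)).exists_bound_of_continuousOn
    hcont.continuousOn
  have hL' : ∀ x, ‖deriv (fun x => Real.log (deriv g x)) x‖ ≤ L := by
    intro x
    obtain ⟨y, hy, hxy⟩ := hper'.exists_mem_Ico₀ one_pos x
    rw [hxy]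
    exact hL y ⟨hy.1, hy.2.le⟩
  refine ⟨L, (norm_nonneg _).trans (hL' 0), ?_, ?_⟩
  · intro a b
    have := Convex.norm_image_sub_le_of_norm_deriv_le (𝕜 := ℝ)
      (f := fun x => Real.log (deriv g x)) (s := Set.univ) (C := L) (x := b) (y := a)
      (fun x _ => (hCD.differentiable one_ne_zero) x) (fun x _ => hL' x) convex_univ
      (Set.mem_univ _) (Set.mem_univ _)
    simpa [Real.norm_eq_abs] using this
  · intro x m
    have := hdper.int_mul m x
    simpa using this

theorem hasDerivAt_iter {g : ℝ → ℝ} (hd : Differentiable ℝ g) (hgder : ∀ x : ℝ, 0 < deriv g x)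
    (m : ℕ) (x : ℝ) :
    HasDerivAt (g^[m]) (Real.exp (∑ i ∈ Finset.range m, Real.log (deriv g (g^[i] x)))) x := by
  induction m with
  | zero => simpa using hasDerivAt_id x
  | succ m ih =>
    rw [Finset.sum_range_succ, Real.exp_add, Real.exp_log (hgder _), mul_comm,
      Function.iterate_succ']
    exact HasDerivAt.comp x (hd _).hasDerivAt ih

theorem iter_add_int {g : ℝ → ℝ} (hgper : ∀ x : ℝ, g (x + 1) = g x + 1) (i : ℕ) (x : ℝ) (m : ℤ) :
    g^[i] (x + m) = g^[i] x + m := by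
  have h1 : ∀ x, ∀ m : ℤ, g (x + m) = g x + m := by
    intro x m
    have hp : Function.Periodic (fun x => g x - x) 1 := fun x => by
      simp only [hgper]; ring
    have := hp.int_mul m x
    simp only [mul_one] at this
    linarith
  induction i with
  | zero => rfl
  | succ i ih => rw [Function.iterate_succ_apply', ih, h1, Function.iterate_succ_apply']

theorem denjoy_iter {g h : ℝ → ℝ} {α : ℝ} (hd : Differentiable ℝ g)
    (hgder : ∀ x : ℝ, 0 < deriv g x) (hgper : ∀ x : ℝ, g (x + 1) = g x + 1)
    (hh : ∀ x, h (g x) = h x + α) (hmono : Monotone h)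
    (hper : ∀ x, ∀ m : ℤ, h (x + m) = h x + m)
    {p b c : ℤ} {q : ℕ} (hq : 0 < q) (hb : p * b + c * (q : ℤ) = 1)
    (hδ : |q * α - p| * q ≤ 1) {L : ℝ} (hL : 0 ≤ L)
    (hφ : ∀ a b, |Real.log (deriv g a) - Real.log (deriv g b)| ≤ L * |a - b|)
    (hφper : ∀ x, ∀ m : ℤ, Real.log (deriv g (x + m)) = Real.log (deriv g x)) (u v : ℝ) :
    |g^[q] u - g^[q] v| ≤ Real.exp (6 * L) * |u - v| ∧
      |u - v| ≤ Real.exp (6 * L) * |g^[q] u - g^[q] v| := by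
  have hD := hasDerivAt_iter hd hgder q
  have hcont : Continuous (g^[q]) := hd.continuous.iterate q
  have hone : ∃ y, ∑ i ∈ Finset.range q, Real.log (deriv g (g^[i] y)) = 0 := by
    obtain ⟨y, _, hy⟩ := exists_hasDerivAt_eq_slope (g^[q]) _ (zero_lt_one' ℝ)
      hcont.continuousOn (fun x _ => hD x)
    have := iter_add_int hgper q 0 1
    simp only [Int.cast_one, zero_add] at this
    rw [this] at hy
    refine ⟨y, ?_⟩
    rw [← Real.exp_eq_one_iff, hy]; simp
  obtain ⟨y, hy⟩ := hone
  have hS : ∀ x, |∑ i ∈ Finset.range q, Real.log (deriv g (g^[i] x))| ≤ 6 * L := by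
    intro x
    have := koksma hh hmono hper hq hb hδ hL hφ hφper x y
    rwa [hy, sub_zero] at this
  have main : ∀ u v, u < v → |g^[q] u - g^[q] v| ≤ Real.exp (6 * L) * |u - v| ∧
      |u - v| ≤ Real.exp (6 * L) * |g^[q] u - g^[q] v| := by
    intro u v huv
    obtain ⟨y, _, hy⟩ := exists_hasDerivAt_eq_slope (g^[q]) _ huv
      hcont.continuousOn (fun x _ => hD x)
    have hvu : 0 < v - u := sub_pos.2 huv
    rw [eq_div_iff hvu.ne'] at hy
    rw [abs_sub_comm, abs_sub_comm u v, ← hy, abs_mul, abs_of_pos hvu, Real.abs_exp]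
    obtain ⟨s1, s2⟩ := abs_le.1 (hS y)
    constructor
    · exact mul_le_mul_of_nonneg_right (Real.exp_le_exp.2 s2) hvu.le
    · rw [← mul_assoc, ← Real.exp_add]
      have : 1 ≤ Real.exp (6 * L + ∑ i ∈ Finset.range q, Real.log (deriv g (g^[i] y))) :=
        Real.one_le_exp (by linarith)
      nlinarith
  rcases lt_trichotomy u v with huv | rfl | huv
  · exact main u v huv
  · simp
  · have := main v u huv
    rwa [abs_sub_comm, abs_sub_comm v u] at this

/-- Displacement at a point between `a` and `G a`. -/
theorem disp_compare {G : ℝ → ℝ} (hG : Monotone G) {K : ℝ} (hK : 1 ≤ K)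
    (h1 : ∀ u v, |G u - G v| ≤ K * |u - v|) (h2 : ∀ u v, |u - v| ≤ K * |G u - G v|)
    {a u : ℝ} (hu : u ∈ Set.uIcc a (G a)) :
    |G u - u| ≤ K * |G a - a| ∧ |G a - a| ≤ K * |G u - u| := by
  have e : |u - a| + |G a - u| = |G a - a| ∧ |G u - u| = |G u - G a| + |G a - u| := by
    rcases Set.mem_uIcc.1 hu with ⟨ha, hb⟩ | ⟨ha, hb⟩
    · have := hG ha
      rw [abs_of_nonneg (sub_nonneg.2 ha), abs_of_nonneg (sub_nonneg.2 hb),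
        abs_of_nonneg (sub_nonneg.2 (ha.trans hb)), abs_of_nonneg (sub_nonneg.2 this),
        abs_of_nonneg (sub_nonneg.2 (hb.trans this))]
      constructor <;> ring
    · have := hG hb
      rw [abs_of_nonpos (sub_nonpos.2 ha), abs_of_nonpos (sub_nonpos.2 hb),
        abs_of_nonpos (sub_nonpos.2 (ha.trans hb)), abs_of_nonpos (sub_nonpos.2 this),
        abs_of_nonpos (sub_nonpos.2 (this.trans ha))]
      constructor <;> ring
  rw [← e.1, e.2]
  have a1 := h1 u a
  have a2 := h2 u a
  have a3 := abs_nonneg (G a - u)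
  constructor <;> nlinarith

theorem arc_dist {G : ℝ → ℝ} (hG : Monotone G) {K : ℝ} (hK : 1 ≤ K)
    (h1 : ∀ u v, |G u - G v| ≤ K * |u - v|) (h2 : ∀ u v, |u - v| ≤ K * |G u - G v|)
    {a u : ℝ} (hu : u ∈ Set.uIcc a (G (G a))) :
    |G u - u| ≤ K ^ 2 * |G a - a| ∧ |G a - a| ≤ K ^ 2 * |G u - u| ∧
      |u - a| ≤ 2 * K * |G a - a| := by
  have hGa : G a ∈ Set.uIcc a (G a) := Set.right_mem_uIcc
  obtain ⟨b1, b2⟩ := disp_compare hG hK h1 h2 hGa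
  have p0 := abs_nonneg (G a - a)
  have p1 := abs_nonneg (G u - u)
  have p2 := abs_nonneg (G (G a) - G a)
  have hcase : u ∈ Set.uIcc a (G a) ∨ u ∈ Set.uIcc (G a) (G (G a)) := by
    rcases le_total u (G a) with hle | hle <;> rcases Set.mem_uIcc.1 hu with ⟨ha, hb⟩ | ⟨ha, hb⟩
    · exact Or.inl (Set.mem_uIcc.2 (Or.inl ⟨ha, hle⟩))
    · exact Or.inr (Set.mem_uIcc.2 (Or.inr ⟨ha, hle⟩))
    · exact Or.inr (Set.mem_uIcc.2 (Or.inl ⟨hle, hb⟩))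
    · exact Or.inl (Set.mem_uIcc.2 (Or.inr ⟨hle, hb⟩))
  rcases hcase with hc | hc
  · obtain ⟨c1, c2⟩ := disp_compare hG hK h1 h2 hc
    have hd : |u - a| ≤ |G a - a| := Set.abs_sub_left_of_mem_uIcc hc
    refine ⟨?_, ?_, ?_⟩ <;> nlinarith [mul_nonneg (sub_nonneg.2 hK) p0,
      mul_nonneg (mul_nonneg (sub_nonneg.2 hK) (by linarith : (0:ℝ) ≤ K)) p0,
      mul_nonneg (mul_nonneg (sub_nonneg.2 hK) (by linarith : (0:ℝ) ≤ K)) p1]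
  · obtain ⟨c1, c2⟩ := disp_compare hG hK h1 h2 hc
    have hd : |u - G a| ≤ |G (G a) - G a| := Set.abs_sub_left_of_mem_uIcc hc
    have ht : |u - a| ≤ |u - G a| + |G a - a| := abs_sub_le _ _ _
    refine ⟨?_, ?_, ?_⟩ 
    · nlinarith
    · nlinarith
    · nlinarith

theorem hyp_bound (R : ℝ) (hR : 1 ≤ R) (y₀ : ℝ) (hy₀ : 1 / 2 < y₀) (hy₀1 : y₀ ≤ 1)
    (N : ℝ) (hN : 0 < N) (z w : ℂ) (u u' m m' : ℝ)
    (hz : z = (u : ℂ) + Complex.I * ((m : ℝ) : ℂ) * ((y₀ : ℝ) : ℂ))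
    (hw : w = (u' : ℂ) + Complex.I * ((m' : ℝ) : ℂ) * ((y₀ : ℝ) : ℂ))
    (hm : N ≤ R * m) (hm' : N ≤ R * m') (hm1 : m ≤ R * N) (hm1' : m' ≤ R * N)
    (huu : |u - u'| ≤ R * N) :
    ∃ (h : 0 < z.im) (h' : 0 < w.im),
      dist (⟨z, h⟩ : UpperHalfPlane) (⟨w, h'⟩ : UpperHalfPlane) ≤ 2 * Real.arsinh (3 * R ^ 2) := by
  have hR0 : 0 < R := by linarith
  have mp : 0 < m := by
    by_contra hc; push Not at hc; nlinarith
  have mp' : 0 < m' := by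
    by_contra hc; push Not at hc; nlinarith
  have hzi : z.im = m * y₀ := by rw [hz]; simp
  have hwi : w.im = m' * y₀ := by rw [hw]; simp
  have hzr : z.re = u := by rw [hz]; simp
  have hwr : w.re = u' := by rw [hw]; simp
  have h : 0 < z.im := by rw [hzi]; nlinarith
  have h' : 0 < w.im := by rw [hwi]; nlinarith
  refine ⟨h, h', ?_⟩
  rw [UpperHalfPlane.dist_eq]
  apply mul_le_mul_of_nonneg_left _ (by norm_num)
  apply Real.arsinh_le_arsinh.2
  change dist z w / (2 * √(z.im * w.im)) ≤ _
  have hsq : N / R * (1 / 2) ≤ √(z.im * w.im) := by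
    apply Real.le_sqrt_of_sq_le
    rw [hzi, hwi, pow_two]
    have q1 : N / R ≤ m := by rw [div_le_iff₀ hR0]; linarith
    have q2 : N / R ≤ m' := by rw [div_le_iff₀ hR0]; linarith
    have q0 : 0 < N / R := by positivity
    apply mul_le_mul
    · exact mul_le_mul q1 hy₀.le (by norm_num) mp.le
    · exact mul_le_mul q2 hy₀.le (by norm_num) mp'.le
    · positivity
    · exact (mul_pos mp (by linarith)).le
  have hdist : dist z w ≤ 3 * (R * N) := by
    rw [Complex.dist_eq]
    have := Complex.norm_le_abs_re_add_abs_im (z - w)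
    rw [Complex.sub_re, Complex.sub_im, hzr, hwr, hzi, hwi] at this
    have e : |m * y₀ - m' * y₀| ≤ R * N := by
      rw [abs_le]; constructor <;> nlinarith
    nlinarith [mul_pos hR0 hN]
  have hpos : 0 < 2 * √(z.im * w.im) := by
    have : 0 < N / R * (1 / 2) := by positivity
    linarith
  rw [div_le_iff₀ hpos]
  have e : 3 * (R * N) = 3 * R ^ 2 * (2 * (N / R * (1 / 2))) := by field_simp
  rw [e] at hdist
  refine hdist.trans (mul_le_mul_of_nonneg_left ?_ (by positivity))
  linarith

theorem exists_semiconj (g : ℝ → ℝ)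
    (hgmono : StrictMono g) (hgsurj : Function.Surjective g)
    (hgper : ∀ x : ℝ, g (x + 1) = g x + 1) (α : ℝ)
    (hrot : ∀ x : ℝ, Tendsto (fun m : ℕ => (g^[m] x - x) / m) atTop (𝓝 α)) :
    ∃ h : ℝ → ℝ, Monotone h ∧ (∀ x, h (g x) = h x + α) ∧
      (∀ x, ∀ m : ℤ, h (x + m) = h x + m) := by
  let f : CircleDeg1Lift := ⟨⟨g, hgmono.monotone⟩, hgper⟩
  have hf : ⇑f = g := rfl
  let t : CircleDeg1Lift := (CircleDeg1Lift.translate (Multiplicative.ofAdd α) : CircleDeg1Lift)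
  have hft : f.translationNumber = t.translationNumber := by
    rw [CircleDeg1Lift.translationNumber_translate]
    apply CircleDeg1Lift.translationNumber_eq_of_tendsto₀
    simpa [hf] using hrot 0
  obtain ⟨F, hF⟩ := CircleDeg1Lift.semiconj_of_bijective_of_translationNumber_eq
    (f₁ := f) (f₂ := t) ⟨hgmono.injective, hgsurj⟩
    (CircleDeg1Lift.isUnit_iff_bijective.1 (Units.isUnit _)) hft
  refine ⟨F, F.monotone, fun x => ?_, fun x m => F.map_add_int x m⟩
  have := hF x
  rw [hf] at this
  rw [this]
  simp [t, add_comm]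

theorem cover_lemma {g h : ℝ → ℝ} {α : ℝ} (hα : Irrational α)
    (hgper : ∀ x : ℝ, g (x + 1) = g x + 1)
    (hh : ∀ x, h (g x) = h x + α) (hmono : Monotone h)
    (hper : ∀ x, ∀ m : ℤ, h (x + m) = h x + m) (n : ℕ)
    (hbij : Function.Bijective (cfIter g α n)) (x u : ℝ) :
    ∃ j < cfQ α (n + 1), ∃ k : ℤ, u ∈ cfJ g α n (g^[j] x + k) := by
  have hqle := (cfQ_pos hα n).2
  have hQ := (cfQ_pos hα (n + 1)).1
  have hq := (cfQ_pos hα n).1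
  set Q := cfQ α (n + 1) with hQdef
  obtain ⟨j, hj, hjmax⟩ := Finset.exists_max_image (Finset.range Q)
    (fun j => g^[j] x + (⌊u - g^[j] x⌋ : ℝ)) ⟨0, Finset.mem_range.2 hQ⟩
  have hjQ : j < Q := Finset.mem_range.1 hj
  set k : ℤ := ⌊u - g^[j] x⌋ with hk
  set z : ℝ := g^[j] x + k with hz
  have hzu : z ≤ u := by have := Int.floor_le (u - g^[j] x); rw [← hk] at this; linarith
  have lt_of_h : ∀ a b, h a < h b → a < b := fun a b hab => hmono.reflect_lt hab
  have hpt : ∀ i, ∀ l : ℤ, h (g^[i] x + l) = h x + i * α + l := fun i l => by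
    rw [hper, h_iter hh]
  have hnext : ∀ i < Q, ∀ l : ℤ, h z < h (g^[i] x + l) → u < g^[i] x + l := by
    intro i hi l hlt
    by_contra hc
    push Not at hc
    have h1 : l ≤ ⌊u - g^[i] x⌋ := Int.le_floor.2 (by linarith)
    have h2 : (l : ℝ) ≤ (⌊u - g^[i] x⌋ : ℝ) := by exact_mod_cast h1
    have h3 := hjmax i (Finset.mem_range.2 hi)
    have := lt_of_h _ _ hlt
    linarith
  have hGh : ∀ a, h (cfIter g α n a) = h a + cfD α n := by
    intro a
    have := hper (g^[cfQ α n] a) (-cfP α n)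
    rw [cfIter, cfD, sub_eq_add_neg, ← Int.cast_neg, this, h_iter hh]
    push_cast; ring
  have hinv : ∀ a, cfIter g α n (Function.invFun (cfIter g α n) a) = a :=
    Function.rightInverse_invFun hbij.2
  have hinvh : ∀ a, h (Function.invFun (cfIter g α n) a) = h a - cfD α n := by
    intro a
    have := hGh (Function.invFun (cfIter g α n) a)
    rw [hinv] at this; linarith
  have hG : ∀ i, ∀ l : ℤ, cfIter g α n (g^[i] x + l) =
      g^[i + cfQ α n] x + ((l - cfP α n : ℤ) : ℝ) := by
    intro i l
    rw [cfIter, iter_add_int hgper, add_comm i, Function.iterate_add_apply]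
    push_cast; ring
  have hfr := cfFract_pos hα (n + 1)
  have hfr1 := Int.fract_lt_one (cfGauss α (n + 1))
  have hDs := cfD_succ hα n
  have hD1 : cfD α (n + 1) = Q * α - cfP α (n + 1) := rfl
  have hD0 : cfD α n = cfQ α n * α - cfP α n := rfl
  rcases lt_or_gt_of_ne (cfD_ne hα n) with hneg | hpos
  · -- negative displacement
    have hDs1 : 0 < cfD α (n + 1) := by rw [hDs]; nlinarith
    have hDs2 : cfD α (n + 1) < - cfD α n := by rw [hDs]; nlinarith
    have hlow : cfIter g α n z ≤ z := (lt_of_h _ _ (by rw [hGh]; linarith)).le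
    by_cases hjq : cfQ α n ≤ j
    · have e : cfIter g α n (g^[j - cfQ α n] x + ((k + cfP α n : ℤ) : ℝ)) = z := by
        rw [hG, Nat.sub_add_cancel hjq, hz]; push_cast; ring
      have e2 : Function.invFun (cfIter g α n) z =
          g^[j - cfQ α n] x + ((k + cfP α n : ℤ) : ℝ) := by
        apply hbij.1; rw [hinv, e]
      have := hnext (j - cfQ α n) (by omega) (k + cfP α n) (by rw [← e2, hinvh]; linarith)
      refine ⟨j, hjQ, k, ?_⟩
      rw [← hz, cfJ, e2]
      exact Set.mem_uIcc.2 (Or.inr ⟨by linarith, this.le⟩)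
    · set w := g^[j + (Q - cfQ α n)] x + ((k - cfP α (n + 1) + cfP α n : ℤ) : ℝ) with hw
      have hhw : h w = h z + cfD α (n + 1) - cfD α n := by
        rw [hw, hz, hpt, hpt, hD1, hD0]
        push_cast [Nat.cast_sub hqle]; ring
      have hj' : j + (Q - cfQ α n) < Q := by omega
      have huw : u < w := hnext _ hj' _ (by rw [← hw, hhw]; linarith)
      have hlap : cfIter g α n w < Function.invFun (cfIter g α n) z :=
        lt_of_h _ _ (by rw [hGh, hinvh, hhw]; linarith)
      rcases le_total u (Function.invFun (cfIter g α n) z) with hle | hle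
      · refine ⟨j, hjQ, k, ?_⟩
        rw [← hz, cfJ]
        exact Set.mem_uIcc.2 (Or.inr ⟨by linarith, hle⟩)
      · refine ⟨_, hj', k - cfP α (n + 1) + cfP α n, ?_⟩
        rw [← hw, cfJ]
        have : w < Function.invFun (cfIter g α n) w := lt_of_h _ _ (by rw [hinvh]; linarith)
        exact Set.mem_uIcc.2 (Or.inr ⟨by linarith, by linarith⟩)
  · -- positive displacement
    have hDs1 : cfD α (n + 1) < 0 := by rw [hDs]; nlinarith
    have hDs2 : - cfD α n < cfD α (n + 1) := by rw [hDs]; nlinarith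
    have hlow : Function.invFun (cfIter g α n) z ≤ z :=
      (lt_of_h _ _ (by rw [hinvh]; linarith)).le
    by_cases hjq : j + cfQ α n < Q
    · have := hnext (j + cfQ α n) hjq (k - cfP α n) (by rw [← hG, hGh]; linarith)
      rw [← hG] at this
      refine ⟨j, hjQ, k, ?_⟩
      rw [← hz, cfJ]
      exact Set.mem_uIcc.2 (Or.inl ⟨by linarith, this.le⟩)
    · push Not at hjq
      have hle0 : Q - cfQ α n ≤ j := by omega
      set w := g^[j - (Q - cfQ α n)] x + ((k + cfP α (n + 1) - cfP α n : ℤ) : ℝ) with hw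
      have hhw : h w = h z - cfD α (n + 1) + cfD α n := by
        rw [hw, hz, hpt, hpt, hD1, hD0]
        push_cast [Nat.cast_sub hqle, Nat.cast_sub hle0]; ring
      have hj' : j - (Q - cfQ α n) < Q := by omega
      have huw : u < w := hnext _ hj' _ (by rw [← hw, hhw]; linarith)
      have hlap : Function.invFun (cfIter g α n) w < cfIter g α n z :=
        lt_of_h _ _ (by rw [hGh, hinvh, hhw]; linarith)
      rcases le_total u (cfIter g α n z) with hle | hle
      · refine ⟨j, hjQ, k, ?_⟩
        rw [← hz, cfJ]
        exact Set.mem_uIcc.2 (Or.inl ⟨by linarith, hle⟩)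
      · refine ⟨_, hj', k + cfP α (n + 1) - cfP α n, ?_⟩
        rw [← hw, cfJ]
        have : w < cfIter g α n w := lt_of_h _ _ (by rw [hGh]; linarith)
        exact Set.mem_uIcc.2 (Or.inl ⟨by linarith, by linarith⟩)

/-- **The arcs `J̃ₙ(g^j(x)+k)` have bounded hyperbolic diameter and cover the curve `Γₙ`.**
Let `g` be the lift of a real-analytic orientation-preserving circle diffeomorphism with
irrational rotation number `α`, and fix `1/2 < y₀ ≤ 1`.  There are `C > 0` and `n₀ ≥ 1` such
that for all `n ≥ n₀` and all `x`: each arc `J̃ₙ(g^j(x)+k) = {u + i |mₙ(u)| y₀ : u ∈ Jₙ(g^j(x)+k)}`,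
`0 ≤ j < q_{n+1}`, `k ∈ ℤ`, has hyperbolic diameter at most `C`, and the intervals
`Jₙ(g^j(x)+k)` cover `ℝ` (so the arcs cover the whole curve `Γₙ`). -/
theorem arcs_cover_curve_bounded_diameter
    (g : ℝ → ℝ) (hganal : ∀ x : ℝ, AnalyticAt ℝ g x)
    (hgmono : StrictMono g) (hgsurj : Function.Surjective g)
    (hgder : ∀ x : ℝ, 0 < deriv g x)
    (hgper : ∀ x : ℝ, g (x + 1) = g x + 1)
    (α : ℝ) (hα : Irrational α)
    (hrot : ∀ x : ℝ, Tendsto (fun m : ℕ => (g^[m] x - x) / m) atTop (𝓝 α))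
    (y₀ : ℝ) (hy₀ : 1 / 2 < y₀) (hy₀1 : y₀ ≤ 1) :
    ∃ C > (0 : ℝ), ∃ n₀ : ℕ, 1 ≤ n₀ ∧ ∀ n ≥ n₀, ∀ x : ℝ,
      (∀ j < cfQ α (n + 1), ∀ k : ℤ,
        ∀ u ∈ cfJ g α n (g^[j] x + k), ∀ u' ∈ cfJ g α n (g^[j] x + k),
          ∃ (h : 0 < (liftPt g α n y₀ u).im) (h' : 0 < (liftPt g α n y₀ u').im),
            dist (⟨liftPt g α n y₀ u, h⟩ : UpperHalfPlane)
              (⟨liftPt g α n y₀ u', h'⟩ : UpperHalfPlane) ≤ C) ∧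
      (⋃ j ∈ Finset.range (cfQ α (n + 1)), ⋃ k : ℤ, cfJ g α n (g^[j] x + k)) = Set.univ := by
  obtain ⟨L, hL, hφ, hφper⟩ := exists_lipschitz_log_deriv g hganal hgder hgper
  obtain ⟨h, hmono, hh, hper⟩ := exists_semiconj g hgmono hgsurj hgper α hrot
  have hd : Differentiable ℝ g := fun x => (hganal x).differentiableAt
  set K := Real.exp (6 * L) with hKdef
  have hK : 1 ≤ K := Real.one_le_exp (by linarith)
  refine ⟨2 * Real.arsinh (3 * (4 * K ^ 2) ^ 2), ?_, 1, le_rfl, fun n _ x => ?_⟩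
  · have : 0 < Real.arsinh (3 * (4 * K ^ 2) ^ 2) := Real.arsinh_pos_iff.2 (by positivity)
    linarith
  have hGm : StrictMono (cfIter g α n) := fun a b hab => by
    have := hgmono.iterate (cfQ α n) hab
    simp only [cfIter]; linarith
  have hbij : Function.Bijective (cfIter g α n) := by
    refine ⟨hGm.injective, fun y => ?_⟩
    obtain ⟨a, ha⟩ := hgsurj.iterate (cfQ α n) (y + cfP α n)
    exact ⟨a, by rw [cfIter, ha]; ring⟩
  constructor
  · intro j _ k
    generalize g^[j] x + k = z
    intro u hu u' hu'
    obtain ⟨b, c, hb⟩ := cf_coprime hα n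
    have hden := denjoy_iter hd hgder hgper hh hmono hper (cfQ_pos hα n).1 hb
      (cfD_bound hα n) hL hφ hφper
    have h1 : ∀ u v, |cfIter g α n u - cfIter g α n v| ≤ K * |u - v| := fun u v => by
      rw [cfIter, cfIter, sub_sub_sub_cancel_right]; exact (hden u v).1
    have h2 : ∀ u v, |u - v| ≤ K * |cfIter g α n u - cfIter g α n v| := fun u v => by
      rw [cfIter, cfIter, sub_sub_sub_cancel_right]; exact (hden u v).2
    set a := Function.invFun (cfIter g α n) z with ha
    have haz : cfIter g α n a = z := Function.rightInverse_invFun hbij.2 z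
    rw [cfJ, ← ha, ← haz] at hu hu'
    obtain ⟨A1, A2, A3⟩ := arc_dist hGm.monotone hK h1 h2 hu
    obtain ⟨B1, B2, B3⟩ := arc_dist hGm.monotone hK h1 h2 hu'
    have hN : 0 < |cfIter g α n a - a| := by
      rw [abs_pos]
      intro h0
      have e : cfIter g α n a = a := by linarith
      have e2 := hper (g^[cfQ α n] a) (-cfP α n)
      rw [h_iter hh, Int.cast_neg, ← sub_eq_add_neg] at e2
      change h (cfIter g α n a) = _ at e2
      rw [e] at e2
      apply cfD_ne hα n
      rw [cfD]; linarith
    have hKK : K ≤ K ^ 2 := by nlinarith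
    set N := |cfIter g α n a - a| with hNdef
    have hR : (1 : ℝ) ≤ 4 * K ^ 2 := by nlinarith
    have p1 := abs_nonneg (cfIter g α n u - u)
    have p2 := abs_nonneg (cfIter g α n u' - u')
    refine hyp_bound (4 * K ^ 2) hR y₀ hy₀ hy₀1 N hN _ _ u u' _ _ rfl rfl ?_ ?_ ?_ ?_ ?_
    · nlinarith [mul_nonneg (sq_nonneg K) p1]
    · nlinarith [mul_nonneg (sq_nonneg K) p2]
    · nlinarith [mul_nonneg (sq_nonneg K) hN.le]
    · nlinarith [mul_nonneg (sq_nonneg K) hN.le]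
    · have t := abs_sub_le u a u'
      rw [abs_sub_comm a u'] at t
      nlinarith [mul_le_mul_of_nonneg_right hKK hN.le]
  · rw [Set.eq_univ_iff_forall]
    intro u
    obtain ⟨j, hj, k, hu⟩ := cover_lemma hα hgper hh hmono hper n hbij x u
    simp only [Set.mem_iUnion, Finset.mem_range]
    exact ⟨j, hj, k, hu⟩
end

section
/- Fix y₀ with 1/2 < y₀ ≤ 1. There exist a constant C₀ > 0 and n₀ ≥ 1 such that for all n ≥ n₀ and all x₀ ∈ ℝ, every point of the curve Γₙ = {u + i·|mₙ(u)|·y₀ : u ∈ ℝ} is within Poincaré distance C₀ (in the upper half-plane ℍ) of some point of the set {g^j(x₀) + k + i·|mₙ(g^j(x₀))|·y₀ : 0 ≤ j < q_{n+1}, k ∈ ℤ}. -/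
open Filter Topology

namespace OD

/-! ### Continued fraction facts -/

lemma gauss_irr {α : ℝ} (hα : Irrational α) (n : ℕ) : Irrational (cfGauss α n) := by
  induction n with
  | zero => exact hα
  | succ n ih =>
    have : Irrational (Int.fract (cfGauss α n)) := by
      rw [Int.fract]; exact ih.sub_intCast _
    exact irrational_inv_iff.mpr this

lemma fract_pos {α : ℝ} (hα : Irrational α) (n : ℕ) : 0 < Int.fract (cfGauss α n) := by
  rcases (Int.fract_nonneg (cfGauss α n)).lt_or_eq with h | h
  · exact h
  · exfalso
    have : Irrational (Int.fract (cfGauss α n)) := by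
      rw [Int.fract]; exact (gauss_irr hα n).sub_intCast _
    rw [← h] at this
    exact this ⟨0, by simp⟩

lemma one_lt_gauss {α : ℝ} (hα : Irrational α) (n : ℕ) : 1 < cfGauss α (n + 1) := by
  show 1 < (Int.fract (cfGauss α n))⁻¹
  exact (one_lt_inv₀ (fract_pos hα n)).mpr (Int.fract_lt_one _)

lemma one_le_cfA {α : ℝ} (hα : Irrational α) (n : ℕ) : 1 ≤ cfA α (n + 1) := by
  rw [cfA, Int.le_floor]; exact_mod_cast (one_lt_gauss hα n).le

/-- `δₙ = qₙ α - pₙ`. -/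
noncomputable def del (α : ℝ) (n : ℕ) : ℝ := cfQ α n * α - cfP α n

lemma toNat_cast {α : ℝ} (hα : Irrational α) (n : ℕ) :
    (((cfA α (n + 1)).toNat : ℕ) : ℤ) = cfA α (n + 1) :=
  Int.toNat_of_nonneg (by linarith [one_le_cfA hα n])

lemma toNat_castR {α : ℝ} (hα : Irrational α) (n : ℕ) :
    (((cfA α (n + 1)).toNat : ℕ) : ℝ) = cfA α (n + 1) := by
  have := toNat_cast hα n
  exact_mod_cast congrArg (fun z : ℤ => (z : ℝ)) this

lemma del_zero (α : ℝ) : del α 0 = Int.fract (cfGauss α 0) := by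
  have : Int.fract (cfGauss α 0) = α - cfA α 0 := rfl
  rw [this]; simp [del, cfQ, cfP]

lemma del_succ {α : ℝ} (hα : Irrational α) (n : ℕ) :
    del α (n + 1) = - Int.fract (cfGauss α (n + 1)) * del α n := by
  induction n with
  | zero =>
    have h0 := fract_pos hα 0
    have h1 : cfGauss α 1 * Int.fract (cfGauss α 0) = 1 := inv_mul_cancel₀ h0.ne'
    have h2 : Int.fract (cfGauss α 0) = α - cfA α 0 := rfl
    have h3 : Int.fract (cfGauss α 1) = cfGauss α 1 - cfA α 1 := rfl
    rw [del_zero, zero_add, h3]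
    have : del α 1 = cfA α 1 * α - (cfA α 1 * cfA α 0 + 1) := by
      simp only [del, cfQ, cfP, toNat_castR hα 0]; push_cast; ring
    rw [this]
    have : -(cfGauss α 1 - cfA α 1) * Int.fract (cfGauss α 0) = 
      cfA α 1 * Int.fract (cfGauss α 0) - cfGauss α 1 * Int.fract (cfGauss α 0) := by ring
    rw [this, h1, h2]; ring
  | succ n ih =>
    have h0 := fract_pos hα (n + 1)
    have h1 : cfGauss α (n + 2) * Int.fract (cfGauss α (n + 1)) = 1 := inv_mul_cancel₀ h0.ne'
    have h3 : Int.fract (cfGauss α (n + 2)) = cfGauss α (n + 2) - cfA α (n + 2) := rfl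
    have : del α (n + 2) = cfA α (n + 2) * del α (n + 1) + del α n := by
      simp only [del, cfQ, cfP]; push_cast; rw [toNat_castR hα (n + 1)]; ring
    rw [this, h3]
    have : del α n = - cfGauss α (n + 2) * del α (n + 1) := by
      rw [ih]; linear_combination (-del α n) * h1
    rw [this]; ring

lemma det {α : ℝ} (hα : Irrational α) (n : ℕ) :
    cfP α (n + 1) * cfQ α n - cfP α n * cfQ α (n + 1) = (-1) ^ n := by
  induction n with
  | zero =>
    simp only [cfP, cfQ, toNat_cast hα 0]; push_cast; ring
  | succ n ih =>
    simp only [cfP, cfQ] at ih ⊢; push_cast; rw [toNat_cast hα (n + 1), pow_succ, ← ih]; ring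

lemma q_pos {α : ℝ} (hα : Irrational α) (n : ℕ) : 0 < cfQ α n ∧ cfQ α n ≤ cfQ α (n + 1) := by
  have ha : ∀ n, 1 ≤ (cfA α (n + 1)).toNat := fun n => by
    have := one_le_cfA hα n; omega
  induction n with
  | zero => exact ⟨Nat.one_pos, ha 0⟩
  | succ n ih =>
    refine ⟨by omega, ?_⟩
    show _ ≤ (cfA α (n + 2)).toNat * cfQ α (n + 1) + cfQ α n
    nlinarith [ha (n + 1)]

lemma del_ne {α : ℝ} (hα : Irrational α) (n : ℕ) : del α n ≠ 0 := by
  induction n with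
  | zero => rw [del_zero]; exact (fract_pos hα 0).ne'
  | succ n ih => rw [del_succ hα]; exact mul_ne_zero (neg_ne_zero.mpr (fract_pos hα _).ne') ih

lemma abs_del_succ {α : ℝ} (hα : Irrational α) (n : ℕ) :
    |del α (n + 1)| = Int.fract (cfGauss α (n + 1)) * |del α n| := by
  rw [del_succ hα, abs_mul, abs_neg, abs_of_pos (fract_pos hα _)]

lemma abs_sum {α : ℝ} (hα : Irrational α) (n : ℕ) :
    |del α n| * cfQ α (n + 1) + |del α (n + 1)| * cfQ α n = 1 := by
  have h1 : del α n * cfQ α (n + 1) - del α (n + 1) * cfQ α n = (-1) ^ n := by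
    have := det hα n
    have h : ((cfP α (n + 1) : ℝ) * cfQ α n - cfP α n * cfQ α (n + 1)) = (-1) ^ n := by
      exact_mod_cast congrArg (fun z : ℤ => (z : ℝ)) this
    rw [← h]; simp only [del]; ring
  have h2 : del α n * (cfQ α (n + 1) + Int.fract (cfGauss α (n + 1)) * cfQ α n) = (-1) ^ n := by
    rw [← h1, del_succ hα]; ring
  have h3 := congrArg abs h2
  have h4 : 0 < (cfQ α (n + 1) + Int.fract (cfGauss α (n + 1)) * cfQ α n : ℝ) := by
    have := fract_pos hα (n + 1)
    have := (q_pos hα n).1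
    have := (q_pos hα (n + 1)).1
    positivity
  rw [abs_mul, abs_of_pos h4, abs_pow, abs_neg, abs_one, one_pow] at h3
  rw [abs_del_succ hα, ← h3]; ring

lemma approx {α : ℝ} (hα : Irrational α) (n : ℕ) : |del α n| * cfQ α n < 1 := by
  have h := abs_sum hα n
  have h1 := abs_pos.mpr (del_ne hα n)
  have h2 := abs_pos.mpr (del_ne hα (n + 1))
  have h3 : (0 : ℝ) < cfQ α n := by exact_mod_cast (q_pos hα n).1
  have h4 : (cfQ α n : ℝ) ≤ cfQ α (n + 1) := by exact_mod_cast (q_pos hα n).2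
  nlinarith [mul_pos h2 h3]

lemma del_lower {α : ℝ} (hα : Irrational α) (n : ℕ) : 1 ≤ 2 * (|del α n| * cfQ α (n + 1)) := by
  have h := abs_sum hα n
  have h1 := abs_pos.mpr (del_ne hα n)
  have h3 : (0 : ℝ) < cfQ α n := by exact_mod_cast (q_pos hα n).1
  have h4 : (cfQ α n : ℝ) ≤ cfQ α (n + 1) := by exact_mod_cast (q_pos hα n).2
  have h5 : |del α (n + 1)| ≤ |del α n| := by
    rw [abs_del_succ hα]; nlinarith [Int.fract_lt_one (cfGauss α (n + 1))]
  have h6 : |del α (n + 1)| * cfQ α n ≤ |del α n| * cfQ α (n + 1) :=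
    mul_le_mul h5 h4 h3.le h1.le
  linarith

lemma coprime {α : ℝ} (hα : Irrational α) (n : ℕ) : IsCoprime (cfP α n) (cfQ α n : ℤ) := by
  have h := det hα n
  have h2 : ((-1 : ℤ) ^ n) * (-1) ^ n = 1 := by rw [← mul_pow]; simp
  refine ⟨-(-1) ^ n * cfQ α (n + 1), (-1) ^ n * cfP α (n + 1), ?_⟩
  linear_combination (-1) ^ n * h + h2

/-! ### Semiconjugacy with the translation -/

lemma exists_semiconj (g : ℝ → ℝ) (hgmono : StrictMono g) (hgsurj : Function.Surjective g)
    (hgper : ∀ x : ℝ, g (x + 1) = g x + 1) (α : ℝ)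
    (hrot : ∀ x : ℝ, Tendsto (fun m : ℕ => (g^[m] x - x) / m) atTop (𝓝 α)) :
    ∃ F : ℝ → ℝ, Monotone F ∧ (∀ x, ∀ k : ℤ, F (x + k) = F x + k) ∧ ∀ x, F (g x) = F x + α := by
  let f : CircleDeg1Lift := ⟨⟨g, hgmono.monotone⟩, hgper⟩
  have hf : ∀ x, f x = g x := fun x => rfl
  have hτ : f.translationNumber = α := by
    refine tendsto_nhds_unique (f.tendsto_translationNumber 0) ?_
    refine (hrot 0).congr fun n => ?_
    rw [CircleDeg1Lift.coe_pow]; rfl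
  obtain ⟨F, hF⟩ := CircleDeg1Lift.semiconj_of_bijective_of_translationNumber_eq
    (f₁ := f) (f₂ := CircleDeg1Lift.translate (Multiplicative.ofAdd α))
    ⟨hgmono.injective, hgsurj⟩
    (CircleDeg1Lift.isUnit_iff_bijective.1 (Units.isUnit _)) (by
      rw [hτ, CircleDeg1Lift.translationNumber_translate])
  refine ⟨F, F.monotone, fun x k => F.map_add_int x k, fun x => ?_⟩
  have := hF.eq x
  rw [hf] at this
  rw [this, CircleDeg1Lift.translate_apply, add_comm]

end OD

namespace OD

lemma F_iter {g F : ℝ → ℝ} {α : ℝ} (hFg : ∀ x, F (g x) = F x + α) (j : ℕ) (x : ℝ) :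
    F (g^[j] x) = F x + j * α := by
  induction j with
  | zero => simp
  | succ j ih => rw [Function.iterate_succ_apply', hFg, ih]; push_cast; ring

lemma orbit_pts {g F : ℝ → ℝ} {α : ℝ} 
    (hFk : ∀ x, ∀ k : ℤ, F (x + k) = F x + k) (hFg : ∀ x, F (g x) = F x + α)
    (p : ℤ) (q : ℕ) (hq : 0 < q) (hpq : IsCoprime p (q : ℤ)) (hap : |q * α - p| * q < 1) :
    ∃ X : ℝ → ℤ → ℝ, (∀ x i, ∃ j < q, ∃ k : ℤ, X x i = g^[j] x + k) ∧
      (∀ x i, |q * (F (X x i) - F x) - i| < 1) ∧ (∀ x i, X x (i + q) = X x i + 1) ∧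
      ∀ φ : ℝ → ℝ, (∀ x, φ (x + 1) = φ x) → ∀ x,
        ∑ i ∈ Finset.range q, φ (X x i) = ∑ j ∈ Finset.range q, φ (g^[j] x) := by
  obtain ⟨a, b, hab⟩ := hpq
  have hqz : (0 : ℤ) < q := by exact_mod_cast hq
  have hqr : (0 : ℝ) < q := by exact_mod_cast hq
  have hr0 : ∀ i : ℤ, 0 ≤ (a * i) % q := fun i => Int.emod_nonneg _ hqz.ne'
  have hrq : ∀ i : ℤ, (a * i) % q < q := fun i => Int.emod_lt_of_pos _ hqz
  refine ⟨fun x i => g^[((a * i) % q).toNat] x + ((b * i + p * ((a * i) / q) : ℤ) : ℝ),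
    ?_, ?_, ?_, ?_⟩
  · intro x i
    refine ⟨_, ?_, _, rfl⟩
    have := hr0 i; have := hrq i; omega
  · intro x i
    simp only [hFk, F_iter hFg]
    set r := (a * i) % q with hr
    have h1 : ((r.toNat : ℕ) : ℝ) = (r : ℝ) := by
      have : ((r.toNat : ℕ) : ℤ) = r := Int.toNat_of_nonneg (hr0 i)
      exact_mod_cast congrArg (fun z : ℤ => (z : ℝ)) this
    have h2 : (q : ℤ) * (b * i + p * ((a * i) / q)) + p * r = i := by
      have := Int.mul_ediv_add_emod (a * i) q
      rw [← hr] at this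
      linear_combination p * this + i * hab
    have h3 : (q : ℝ) * ((b * i + p * ((a * i) / q) : ℤ) : ℝ) + p * r = i := by exact_mod_cast h2
    have h4 : (q : ℝ) * (F x + (r.toNat : ℕ) * α + ((b * i + p * ((a * i) / q) : ℤ) : ℝ) - F x) - i
        = r * (q * α - p) := by
      rw [h1]; linear_combination h3
    rw [h4, abs_mul]
    have h5 : (0 : ℝ) ≤ r := by exact_mod_cast hr0 i
    have h6 : (r : ℝ) ≤ q := by exact_mod_cast (hrq i).le
    rw [abs_of_nonneg h5]
    nlinarith [abs_nonneg (q * α - p)]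
  · intro x i
    have h1 : a * (i + q) = a * i + a * q := by ring
    simp only [h1, Int.add_mul_emod_self_right, Int.add_mul_ediv_right _ _ hqz.ne']
    have h2 : b * (i + q) + p * (a * i / q + a) = (b * i + p * (a * i / q)) + 1 := by
      linear_combination hab
    rw [h2]; push_cast; ring
  · intro φ hφ x
    have hφk : ∀ x (k : ℤ), φ (x + k) = φ x := fun x k => by
      have : Function.Periodic φ 1 := hφ
      simpa using (this.int_mul k) x
    simp only [hφk]
    refine Finset.sum_nbij' (fun i : ℕ => ((a * i) % q).toNat) (fun j : ℕ => ((p * j) % q).toNat)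
      ?_ ?_ ?_ ?_ ?_
    · intro i hi
      have := hr0 i; have := hrq i; rw [Finset.mem_range]; omega
    · intro i hi
      have := Int.emod_nonneg (p * i) hqz.ne'; have := Int.emod_lt_of_pos (p * i) hqz
      rw [Finset.mem_range]; omega
    · intro i hi
      rw [Finset.mem_range] at hi
      have h1 : ((((a * i) % q).toNat : ℕ) : ℤ) = (a * i) % q := Int.toNat_of_nonneg (hr0 i)
      rw [h1]
      have h2 : (p * ((a * i) % q)) % q = (i : ℤ) % q := by
        rw [Int.mul_emod, Int.emod_emod_of_dvd _ dvd_rfl, ← Int.mul_emod]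
        apply Int.emod_emod_of_dvd _ dvd_rfl |>.symm.trans
        rw [Int.emod_emod_of_dvd _ dvd_rfl]
        apply Int.ModEq.symm
        exact (Int.modEq_iff_dvd).mpr ⟨-(b * i), by linear_combination i * hab⟩
      rw [h2, Int.emod_eq_of_lt (by positivity) (by exact_mod_cast hi)]; simp
    · intro i hi
      rw [Finset.mem_range] at hi
      have h1 : ((((p * i) % q).toNat : ℕ) : ℤ) = (p * i) % q :=
        Int.toNat_of_nonneg (Int.emod_nonneg _ hqz.ne')
      rw [h1]
      have h2 : (a * ((p * i) % q)) % q = (i : ℤ) % q := by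
        rw [Int.mul_emod, Int.emod_emod_of_dvd _ dvd_rfl, ← Int.mul_emod]
        apply Int.ModEq.symm
        exact (Int.modEq_iff_dvd).mpr ⟨-(b * i), by linear_combination i * hab⟩
      rw [h2, Int.emod_eq_of_lt (by positivity) (by exact_mod_cast hi)]; simp
    · intro i hi; rfl

lemma sum_shift {q : ℕ} {Ψ : ℤ → ℝ} (h : ∀ i, Ψ (i + q) = Ψ i) (c : ℤ) :
    ∑ i ∈ Finset.range q, Ψ (i + c) = ∑ i ∈ Finset.range q, Ψ i := by
  have step : ∀ c : ℤ, ∑ i ∈ Finset.range q, Ψ (i + (c + 1)) = ∑ i ∈ Finset.range q, Ψ (i + c) := by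
    intro c
    have h1 := Finset.sum_range_succ (fun i : ℕ => Ψ (i + c)) q
    have h2 := Finset.sum_range_succ' (fun i : ℕ => Ψ (i + c)) q
    rw [h1] at h2
    have h3 : Ψ ((q : ℤ) + c) = Ψ (((0 : ℕ) : ℤ) + c) := by
      rw [add_comm, h]; simp
    rw [h3] at h2
    have h4 := add_right_cancel h2
    rw [h4]
    refine Finset.sum_congr rfl fun i _ => ?_
    congr 1; push_cast; ring
  induction c using Int.induction_on with
  | zero => simp
  | succ n ih => rw [step, ih]
  | pred n ih => rw [← ih, ← step]; simp

lemma sum_gap {q : ℕ} {X : ℤ → ℝ} (h : ∀ i, X (i + q) = X i + 1) (c : ℤ) :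
    ∑ i ∈ Finset.range q, (X (i + (c + 1)) - X (i + c)) = 1 := by
  have := Finset.sum_range_sub (fun i : ℕ => X (i + c)) q
  have h3 : X ((q : ℤ) + c) = X (((0 : ℕ) : ℤ) + c) + 1 := by
    rw [add_comm, h]; simp
  rw [h3] at this
  rw [add_sub_cancel_left] at this
  rw [← this]
  refine Finset.sum_congr rfl fun i _ => ?_
  congr 2; push_cast; ring

lemma koksma {g F : ℝ → ℝ} {α : ℝ} (hF : Monotone F)
    (hFk : ∀ x, ∀ k : ℤ, F (x + k) = F x + k) (hFg : ∀ x, F (g x) = F x + α)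
    (p : ℤ) (q : ℕ) (hq : 0 < q) (hpq : IsCoprime p (q : ℤ)) (hap : |q * α - p| * q < 1)
    (φ : ℝ → ℝ) (hφ : ∀ x, φ (x + 1) = φ x) (L : ℝ) (hL0 : 0 ≤ L)
    (hL : ∀ x y, |φ x - φ y| ≤ L * |x - y|) (x y : ℝ) :
    |∑ j ∈ Finset.range q, φ (g^[j] x) - ∑ j ∈ Finset.range q, φ (g^[j] y)| ≤ L * 5 := by
  obtain ⟨X, -, hX2, hX3, hX4⟩ := orbit_pts hFk hFg p q hq hpq hap
  have hqr : (0 : ℝ) < q := by exact_mod_cast hq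
  -- shift of index
  set c : ℤ := -⌊q * (F y - F x)⌋ with hc
  have hc1 : 0 ≤ q * (F y - F x) + c := by
    have := Int.floor_le (q * (F y - F x)); rw [hc]; push_cast; linarith
  have hc2 : q * (F y - F x) + c < 1 := by
    have := Int.lt_floor_add_one (q * (F y - F x)); rw [hc]; push_cast; linarith
  have lt_of : ∀ u v, q * (F u - F x) < q * (F v - F x) → u < v := by
    intro u v h
    by_contra h'
    have := hF (not_lt.mp h')
    nlinarith
  have hb1 : ∀ i : ℤ, |X x i - X y (i + c)| ≤ X x (i + 3) - X x (i - 2) := by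
    intro i
    have a0 := abs_lt.mp (hX2 x i)
    have a1 := abs_lt.mp (hX2 x (i + 3))
    have a2 := abs_lt.mp (hX2 x (i - 2))
    have a3 := abs_lt.mp (hX2 y (i + c))
    push_cast at a0 a1 a2 a3
    have b1 : X x (i - 2) < X x i := lt_of _ _ (by linarith)
    have b2 : X x i < X x (i + 3) := lt_of _ _ (by linarith)
    have b3 : X x (i - 2) < X y (i + c) := lt_of _ _ (by linarith)
    have b4 : X y (i + c) < X x (i + 3) := lt_of _ _ (by linarith)
    rw [abs_le]; constructor <;> linarith
  rw [← hX4 φ hφ x, ← hX4 φ hφ y,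
    ← sum_shift (Ψ := fun i => φ (X y i)) (q := q) (by intro i; simp only [hX3, hφ]) c,
    ← Finset.sum_sub_distrib]
  calc _ ≤ ∑ i ∈ Finset.range q, |φ (X x i) - φ (X y (i + c))| := Finset.abs_sum_le_sum_abs _ _
    _ ≤ ∑ i ∈ Finset.range q, L * (X x (i + 3) - X x (i - 2)) := by
        refine Finset.sum_le_sum fun i _ => (hL _ _).trans ?_
        exact mul_le_mul_of_nonneg_left (hb1 i) hL0
    _ = L * 5 := by
        rw [← Finset.mul_sum]
        congr 1
        have e0 := sum_gap (hX3 x) (-2)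
        have e1 := sum_gap (hX3 x) (-1)
        have e2 := sum_gap (hX3 x) 0
        have e3 := sum_gap (hX3 x) 1
        have e4 := sum_gap (hX3 x) 2
        norm_num only at e0 e1 e2 e3 e4
        have : (5 : ℝ) = 1 + 1 + 1 + 1 + 1 := by norm_num
        rw [this]
        nth_rewrite 1 [← e0]
        nth_rewrite 1 [← e1]
        nth_rewrite 1 [← e2]
        nth_rewrite 1 [← e3]
        nth_rewrite 1 [← e4]
        simp only [← Finset.sum_add_distrib]
        refine Finset.sum_congr rfl fun i _ => ?_
        have : (i : ℤ) - 2 = i + -2 := by ring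
        rw [this]; ring

end OD

namespace OD

lemma iter_per {g : ℝ → ℝ} (hgper : ∀ x : ℝ, g (x + 1) = g x + 1) (q : ℕ) (x : ℝ) :
    g^[q] (x + 1) = g^[q] x + 1 := by
  induction q with
  | zero => rfl
  | succ q ih => rw [Function.iterate_succ_apply', Function.iterate_succ_apply', ih, hgper]

lemma add_int_of_per {G : ℝ → ℝ} (h : ∀ x : ℝ, G (x + 1) = G x + 1) (x : ℝ) (k : ℤ) :
    G (x + k) = G x + k := by
  have hp : Function.Periodic (fun y => G y - y) 1 := fun y => by simp only [h]; ring
  have := (hp.int_mul k) x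
  simp only [mul_one] at this
  linarith

lemma exists_lip {g : ℝ → ℝ} (hganal : ∀ x : ℝ, AnalyticAt ℝ g x) (hgder : ∀ x : ℝ, 0 < deriv g x)
    (hgper : ∀ x : ℝ, g (x + 1) = g x + 1) :
    (∀ x, Real.log (deriv g (x + 1)) = Real.log (deriv g x)) ∧ ∃ L : ℝ, 0 ≤ L ∧
      ∀ x y, |Real.log (deriv g x) - Real.log (deriv g y)| ≤ L * |x - y| := by
  have hper : ∀ x, deriv g (x + 1) = deriv g x := by
    intro x
    have h1 : (fun y => g (y + 1)) = fun y => g y + 1 := funext hgper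
    have h2 := deriv_comp_add_const g 1 x
    rw [h1, deriv_add_const] at h2
    exact h2.symm
  refine ⟨fun x => by rw [hper], ?_⟩
  set φ : ℝ → ℝ := fun x => Real.log (deriv g x) with hφ
  have hφa : ∀ x, AnalyticAt ℝ φ x := fun x => ((hganal x).deriv).log (hgder x)
  have hφp : ∀ x, φ (x + 1) = φ x := fun x => by simp only [hφ, hper]
  have hdp : Function.Periodic (deriv φ) 1 := by
    intro x
    have h1 : (fun y => φ (y + 1)) = φ := funext hφp
    have h2 := deriv_comp_add_const φ 1 x
    rw [h1] at h2
    exact h2.symm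
  have hdc : Continuous (deriv φ) :=
    continuous_iff_continuousAt.mpr fun x => (hφa x).deriv.continuousAt
  obtain ⟨C, hC⟩ := (isCompact_Icc (a := (0 : ℝ)) (b := 1)).exists_bound_of_continuousOn
    hdc.continuousOn
  have hC' : ∀ x, ‖deriv φ x‖ ≤ C := by
    intro x
    obtain ⟨y, hy, hxy⟩ := hdp.exists_mem_Ico₀ one_pos x
    rw [hxy]; exact hC y ⟨hy.1, hy.2.le⟩
  refine ⟨C, (norm_nonneg _).trans (hC' 0), fun x y => ?_⟩
  exact convex_univ.norm_image_sub_le_of_norm_deriv_le (f := φ)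
    (fun z _ => (hφa z).differentiableAt) (fun z _ => hC' z) (Set.mem_univ y) (Set.mem_univ x)

lemma iter_deriv {g : ℝ → ℝ} (hd : ∀ x, DifferentiableAt ℝ g x) (hgder : ∀ x : ℝ, 0 < deriv g x)
    (q : ℕ) (x : ℝ) :
    HasDerivAt (g^[q]) (Real.exp (∑ j ∈ Finset.range q, Real.log (deriv g (g^[j] x)))) x := by
  induction q with
  | zero => simpa using hasDerivAt_id x
  | succ q ih =>
    rw [Finset.sum_range_succ, Real.exp_add, Real.exp_log (hgder _), Function.iterate_succ',
      mul_comm]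
    exact (hd (g^[q] x)).hasDerivAt.comp x ih

lemma bilip {G : ℝ → ℝ} {G' : ℝ → ℝ} (hG : ∀ x, HasDerivAt G (G' x) x) {M : ℝ} 
    (h1 : ∀ x, G' x ≤ M) (h2 : ∀ x, 1 ≤ M * G' x) (h0 : ∀ x, 0 < G' x) (a b : ℝ) :
    |G a - G b| ≤ M * |a - b| ∧ |a - b| ≤ M * |G a - G b| := by
  wlog hab : b < a generalizing a b
  · rcases (not_lt.mp hab).lt_or_eq with h | h
    · rw [abs_sub_comm (G a), abs_sub_comm a]; exact this b a h
    · simp [h]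
  obtain ⟨c, -, hc⟩ := exists_hasDerivAt_eq_slope G G' hab
    (fun x _ => (hG x).continuousAt.continuousWithinAt) (fun x _ => hG x)
  have hpos : 0 < a - b := sub_pos.mpr hab
  have e : G a - G b = G' c * (a - b) := by rw [hc]; field_simp
  rw [e, abs_mul, abs_of_pos hpos, abs_of_pos (h0 c)]
  constructor
  · exact mul_le_mul_of_nonneg_right (h1 c) hpos.le
  · nlinarith [h2 c]

lemma iter_dist {G : ℝ → ℝ} {M : ℝ} (hM : 1 ≤ M)
    (h : ∀ a b, |G a - G b| ≤ M * |a - b| ∧ |a - b| ≤ M * |G a - G b|) (k : ℕ) (w : ℝ) :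
    |G^[k] w - w| ≤ k * M ^ k * |G w - w| ∧ |G (G^[k] w) - G^[k] w| ≤ M ^ k * |G w - w| ∧
      |G w - w| ≤ M ^ k * |G (G^[k] w) - G^[k] w| := by
  have hM0 : 0 < M := by linarith
  induction k with
  | zero => simp
  | succ k ih =>
    obtain ⟨i1, i2, i3⟩ := ih
    rw [Function.iterate_succ_apply']
    set z := G^[k] w
    have hp : M ^ k ≤ M ^ (k + 1) := pow_le_pow_right₀ hM (Nat.le_succ k)
    have hd := abs_nonneg (G w - w)
    refine ⟨?_, ?_, ?_⟩
    · have : |G z - w| ≤ |G z - z| + |z - w| := abs_sub_le _ _ _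
      have h1 : k * M ^ k * |G w - w| ≤ k * M ^ (k + 1) * |G w - w| := by gcongr
      have h2 : M ^ k * |G w - w| ≤ M ^ (k + 1) * |G w - w| := by gcongr
      push_cast
      linarith
    · have := (h (G z) z).1
      rw [pow_succ]
      nlinarith
    · have h1 := (h (G z) z).2
      have h2 := mul_le_mul_of_nonneg_left h1 (pow_pos hM0 k).le
      rw [pow_succ]; linarith

lemma hyp_bound {K R A B y₀ : ℝ} (hA : 0 < A) (hB : 0 < B) (hy₀ : 1 / 2 < y₀)
    (hAB : A ≤ R * B) (hBA : B ≤ R * A) (z w : UpperHalfPlane)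
    (h1 : |z.re - w.re| ≤ K * A) (h2 : |z.re - w.re| ≤ K * B)
    (hz : z.im = A * y₀) (hw : w.im = B * y₀) :
    dist z w ≤ 2 * (2 * K ^ 2 + R) := by
  have hc := UpperHalfPlane.cosh_dist' z w
  have hy : 0 < y₀ := by linarith
  have hcosh : Real.cosh (dist z w) ≤ 2 * K ^ 2 + R := by
    rw [hc, hz, hw, div_le_iff₀ (by positivity)]
    have e1 : (z.re - w.re) ^ 2 ≤ K ^ 2 * (A * B) := by
      rw [← sq_abs]
      have := mul_le_mul h1 h2 (abs_nonneg _) ((abs_nonneg _).trans h1)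
      nlinarith
    have hy2 : 1 ≤ 4 * y₀ ^ 2 := by nlinarith
    have e2 : K ^ 2 * (A * B) ≤ K ^ 2 * (A * B) * (4 * y₀ ^ 2) :=
      le_mul_of_one_le_right (by positivity) hy2
    have e3 : (A * A + B * B) * y₀ ^ 2 ≤ (2 * R * (A * B)) * y₀ ^ 2 := by
      have a1 := mul_le_mul_of_nonneg_left hAB hA.le
      have a2 := mul_le_mul_of_nonneg_left hBA hB.le
      apply mul_le_mul_of_nonneg_right _ (by positivity)
      linarith
    linarith
  have h3 := Real.add_one_le_exp (dist z w)
  have h4 := Real.exp_pos (-(dist z w))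
  rw [Real.cosh_eq] at hcosh
  linarith

end OD


/-- **The lifted orbit is `C₀`-dense in the curve `Γₙ` for the hyperbolic metric.**
Let `g` be the lift of a real-analytic orientation-preserving circle diffeomorphism with
irrational rotation number `α`, and fix `1/2 < y₀ ≤ 1`.  There are `C₀ > 0` and `n₀ ≥ 1` such
that for all `n ≥ n₀` and all `x₀`, every point of `Γₙ = {u + i |mₙ(u)| y₀ : u ∈ ℝ}` is within
hyperbolic distance `C₀` of some point `g^j(x₀) + k + i |mₙ(g^j(x₀))| y₀`, `0 ≤ j < q_{n+1}`,
`k ∈ ℤ`. -/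
theorem orbit_dense_in_curve
    (g : ℝ → ℝ) (hganal : ∀ x : ℝ, AnalyticAt ℝ g x)
    (hgmono : StrictMono g) (hgsurj : Function.Surjective g)
    (hgder : ∀ x : ℝ, 0 < deriv g x)
    (hgper : ∀ x : ℝ, g (x + 1) = g x + 1)
    (α : ℝ) (hα : Irrational α)
    (hrot : ∀ x : ℝ, Tendsto (fun m : ℕ => (g^[m] x - x) / m) atTop (𝓝 α))
    (y₀ : ℝ) (hy₀ : 1 / 2 < y₀) (hy₀1 : y₀ ≤ 1) :
    ∃ C₀ > (0 : ℝ), ∃ n₀ : ℕ, 1 ≤ n₀ ∧ ∀ n ≥ n₀, ∀ x₀ u : ℝ,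
      ∃ j < cfQ α (n + 1), ∃ k : ℤ,
        ∃ (h : 0 < (liftPt g α n y₀ u).im)
          (h' : 0 < ((liftPt g α n y₀ (g^[j] x₀)) + ((k : ℝ) : ℂ)).im),
          dist (⟨liftPt g α n y₀ u, h⟩ : UpperHalfPlane)
            (⟨(liftPt g α n y₀ (g^[j] x₀)) + ((k : ℝ) : ℂ), h'⟩ : UpperHalfPlane) ≤ C₀ := by
  obtain ⟨F, hF, hFk, hFg⟩ := OD.exists_semiconj g hgmono hgsurj hgper α hrot
  obtain ⟨hφp, L, hL0, hL⟩ := OD.exists_lip hganal hgder hgper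
  set M : ℝ := Real.exp (L * 5) with hM
  have hM1 : 1 ≤ M := Real.one_le_exp (by positivity)
  set K : ℝ := 6 * M ^ 12 with hK
  set R : ℝ := 1 + (M + 1) * K with hR
  have hK0 : 0 < K := by positivity
  have hR0 : 0 < R := by positivity
  refine ⟨2 * (2 * K ^ 2 + R), by positivity, 1, le_rfl, ?_⟩
  intro n _ x₀ u
  have hq := (OD.q_pos hα n).1
  have hq1 := (OD.q_pos hα (n + 1)).1
  set G : ℝ → ℝ := cfIter g α n with hG
  have hGx : ∀ x, G x = g^[cfQ α n] x - cfP α n := fun x => rfl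
  -- derivative bounds
  set S : ℝ → ℝ := fun x => ∑ j ∈ Finset.range (cfQ α n), Real.log (deriv g (g^[j] x)) with hS
  have hGd : ∀ x, HasDerivAt G (Real.exp (S x)) x := fun x =>
    (OD.iter_deriv (fun y => (hganal y).differentiableAt) hgder (cfQ α n) x).sub_const _
  have hGper : ∀ x, G (x + 1) = G x + 1 := fun x => by
    rw [hGx, hGx, OD.iter_per hgper]; ring
  have hGk : ∀ x (k : ℤ), G (x + k) = G x + k := OD.add_int_of_per hGper
  obtain ⟨y, -, hy⟩ := exists_hasDerivAt_eq_slope G (fun x => Real.exp (S x)) (zero_lt_one' ℝ)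
    (fun x _ => (hGd x).continuousAt.continuousWithinAt) (fun x _ => hGd x)
  have hy' : S y = 0 := by
    have : G 1 = G 0 + 1 := by simpa using hGper 0
    rw [this] at hy
    simpa using hy
  have hSb : ∀ x, |S x| ≤ L * 5 := by
    intro x
    have := OD.koksma hF hFk hFg (cfP α n) (cfQ α n) hq (OD.coprime hα n) (OD.approx hα n)
      (fun x => Real.log (deriv g x)) hφp L hL0 hL x y
    have e : |S x - S y| ≤ L * 5 := this
    rwa [hy', sub_zero] at e
  have hbl := OD.bilip hGd (M := M) (fun x => Real.exp_le_exp.mpr (abs_le.mp (hSb x)).2)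
    (fun x => by
      rw [hM, ← Real.exp_add]
      exact Real.one_le_exp (by linarith [(abs_le.mp (hSb x)).1])) (fun x => Real.exp_pos _)
  have hGmono : StrictMono G := by
    intro a b hab
    rw [hGx, hGx]
    exact sub_lt_sub_right (hgmono.iterate _ hab) _
  have hGsurj : Function.Surjective G := by
    intro z
    obtain ⟨w, hw⟩ := hgsurj.iterate (cfQ α n) (z + cfP α n)
    exact ⟨w, by rw [hGx, hw]; ring⟩
  have hFG : ∀ x, F (G x) = F x + OD.del α n := by
    intro x
    have e : G x = g^[cfQ α n] x + ((-cfP α n : ℤ) : ℝ) := by rw [hGx]; push_cast; ring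
    rw [e, hFk, OD.F_iter hFg, OD.del]; push_cast; ring
  have hd : ∀ x, 0 < |G x - x| := by
    intro x
    rw [abs_pos, sub_ne_zero]
    intro h
    have := hFG x
    rw [h] at this
    exact OD.del_ne hα n (by linarith)
  have hF6 : F (G^[6] u) = F u + 6 * OD.del α n := by
    have := OD.F_iter hFG 6 u
    exact_mod_cast this
  -- choose the point
  obtain ⟨X, hX1, hX2, -, -⟩ := OD.orbit_pts hFk hFg (cfP α (n + 1)) (cfQ α (n + 1)) hq1
    (OD.coprime hα (n + 1)) (OD.approx hα (n + 1))
  have hqr : (0 : ℝ) < cfQ α (n + 1) := by exact_mod_cast hq1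
  have hlow := OD.del_lower hα n
  have lt_of : ∀ a b, F a < F b → a < b := fun a b h => by
    by_contra h'
    exact absurd (hF (not_lt.mp h')) (not_le.mpr h)
  have lt_of' : ∀ a b, cfQ α (n + 1) * (F a - F x₀) < cfQ α (n + 1) * (F b - F x₀) → a < b := by
    intro a b h
    apply lt_of
    have := lt_of_mul_lt_mul_left h hqr.le
    linarith
  set Q : ℝ := ((cfQ α (n + 1) : ℕ) : ℝ) with hQ
  have hex : ∃ i : ℤ, ∃ v, G^[6] v = X x₀ i ∧ |X x₀ i - u| ≤ |G^[6] u - u| ∧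
      |X x₀ i - u| ≤ |G^[6] v - v| := by
    rcases lt_or_gt_of_ne (OD.del_ne hα n) with hneg | hpos
    · rw [abs_of_neg hneg] at hlow
      set i : ℤ := ⌊Q * (F u - F x₀)⌋ - 1 with hi
      have f1 := Int.floor_le (Q * (F u - F x₀))
      have f2 := Int.lt_floor_add_one (Q * (F u - F x₀))
      have a0 := abs_lt.mp (hX2 x₀ i)
      rw [hi] at a0
      push_cast at a0
      rw [← hi] at a0
      obtain ⟨v, hv⟩ := hGsurj.iterate 6 (X x₀ i)
      have b1 : X x₀ i < u := lt_of' _ _ (by linarith)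
      have b2 : G^[6] u < X x₀ i := lt_of' _ _ (by rw [hF6]; linarith)
      have b3 : u < v := by
        rw [← hv] at b2
        exact (hGmono.iterate 6).lt_iff_lt.mp b2
      refine ⟨i, v, hv, ?_, ?_⟩
      · rw [abs_of_neg (by linarith), abs_of_neg (by linarith)]; linarith
      · rw [hv, abs_of_neg (by linarith), abs_of_neg (by linarith)]; linarith
    · rw [abs_of_pos hpos] at hlow
      set i : ℤ := ⌊Q * (F u - F x₀)⌋ + 2 with hi
      have f1 := Int.floor_le (Q * (F u - F x₀))
      have f2 := Int.lt_floor_add_one (Q * (F u - F x₀))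
      have a0 := abs_lt.mp (hX2 x₀ i)
      rw [hi] at a0
      push_cast at a0
      rw [← hi] at a0
      obtain ⟨v, hv⟩ := hGsurj.iterate 6 (X x₀ i)
      have b1 : u < X x₀ i := lt_of' _ _ (by linarith)
      have b2 : X x₀ i < G^[6] u := lt_of' _ _ (by rw [hF6]; linarith)
      have b3 : v < u := by
        rw [← hv] at b2
        exact (hGmono.iterate 6).lt_iff_lt.mp b2
      refine ⟨i, v, hv, ?_, ?_⟩
      · rw [abs_of_pos (by linarith), abs_of_pos (by linarith)]; linarith
      · rw [hv, abs_of_pos (by linarith), abs_of_pos (by linarith)]; linarith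
  obtain ⟨i, v, hv, hu1, hv1⟩ := hex
  obtain ⟨j, hj, k, hjk⟩ := hX1 x₀ i
  set x := X x₀ i with hx
  have hMp : (0 : ℝ) < M := by linarith
  have k1 : |x - u| ≤ K * |G u - u| := by
    have e := (OD.iter_dist hM1 hbl 6 u).1
    have e2 : M ^ 6 ≤ M ^ 12 := pow_le_pow_right₀ hM1 (by norm_num)
    push_cast at e
    have e3 : 6 * M ^ 6 * |G u - u| ≤ K * |G u - u| := by
      rw [hK]; gcongr
    linarith
  have k2 : |x - u| ≤ K * |G x - x| := by
    have e := OD.iter_dist hM1 hbl 6 v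
    rw [hv] at e
    have e1 := e.1
    rw [hv] at hv1
    push_cast at e1
    have e3 : 6 * M ^ 6 * |G v - v| ≤ 6 * M ^ 6 * (M ^ 6 * |G x - x|) := by
      gcongr; exact e.2.2
    have e4 : 6 * M ^ 6 * (M ^ 6 * |G x - x|) = K * |G x - x| := by rw [hK]; ring
    linarith
  have k3 : |(G x - x) - (G u - u)| ≤ (M + 1) * |x - u| := by
    have e : (G x - x) - (G u - u) = (G x - G u) - (x - u) := by ring
    have e1 := abs_sub (G x - G u) (x - u)
    have e2 := (hbl x u).1
    rw [e]; linarith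
  have r1 : |G u - u| ≤ R * |G x - x| := by
    have e := abs_sub_abs_le_abs_sub (G u - u) (G x - x)
    rw [abs_sub_comm] at k3
    have e2 := mul_le_mul_of_nonneg_left k2 (by linarith : (0 : ℝ) ≤ M + 1)
    rw [hR]; linarith
  have r2 : |G x - x| ≤ R * |G u - u| := by
    have e := abs_sub_abs_le_abs_sub (G x - x) (G u - u)
    have e2 := mul_le_mul_of_nonneg_left k1 (by linarith : (0 : ℝ) ≤ M + 1)
    rw [hR]; linarith
  have hy0 : 0 < y₀ := by linarith
  have hdx : |G (g^[j] x₀) - g^[j] x₀| = |G x - x| := by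
    rw [hjk, hGk]; congr 1; ring
  have him : ∀ t, (liftPt g α n y₀ t).im = |G t - t| * y₀ := by
    intro t; simp [liftPt, ← hG]
  have hre : ∀ t, (liftPt g α n y₀ t).re = t := by
    intro t; simp [liftPt]
  have him' : ((liftPt g α n y₀ (g^[j] x₀)) + ((k : ℝ) : ℂ)).im = |G x - x| * y₀ := by
    rw [Complex.add_im, him, hdx, Complex.ofReal_im, add_zero]
  have hre' : ((liftPt g α n y₀ (g^[j] x₀)) + ((k : ℝ) : ℂ)).re = x := by
    rw [Complex.add_re, hre, Complex.ofReal_re, hjk]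
  refine ⟨j, hj, k, ?_, ?_, ?_⟩
  · rw [him]; exact mul_pos (hd u) hy0
  · rw [him']; exact mul_pos (hd x) hy0
  · refine OD.hyp_bound (hd u) (hd x) hy₀ r1 r2 _ _ ?_ ?_ (him u) him'
    · show |(liftPt g α n y₀ u).re - ((liftPt g α n y₀ (g^[j] x₀)) + ((k : ℝ) : ℂ)).re| ≤ _
      rw [hre, hre', abs_sub_comm]; exact k1
    · show |(liftPt g α n y₀ u).re - ((liftPt g α n y₀ (g^[j] x₀)) + ((k : ℝ) : ℂ)).re| ≤ _
      rw [hre, hre', abs_sub_comm]; exact k2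
end
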